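/- Let P be a transition kernel and π₁, π₂ two policies. Then for every t ≥ 0, the time-t state–action distributions satisfy D_TV(d_{π₁,P,t}, d_{π₂,P,t}) ≤ (t+1) · max_{s∈S} D_TV(π₁(s), π₂(s)). -/

import Mathlib

open scoped BigOperators

/-- Total variation distance between two PMFs on a finite type. -/
noncomputable def DTV {α : Type*} [Fintype α] (p q : PMF α) : ℝ :=
  (1 / 2) * ∑ x, |(p x).toReal - (q x).toReal|

/-- The time-`t` state–action distribution of policy `π` in the MDP with transition
kernel `P` and initial state distribution `ρ₀`. -/
noncomputable def stateActionDist {S A : Type*} (π : S → PMF A) (P : S × A → PMF S)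
    (ρ₀ : PMF S) : ℕ → PMF (S × A)
  | 0 => ρ₀.bind fun s => (π s).map fun a => (s, a)
  | (t + 1) => (stateActionDist π P ρ₀ t).bind fun sa =>
      (P sa).bind fun s' => (π s').map fun a' => (s', a')

/-- The expected discounted return of policy `π` under transition kernel `P`,
initial distribution `ρ₀`, discount `γ` and reward `R`. -/
noncomputable def Vret {S A : Type*} [Fintype S] [Fintype A] (π : S → PMF A)
    (P : S × A → PMF S) (ρ₀ : PMF S) (γ : ℝ) (R : S × A → ℝ) : ℝ :=
  ∑' t : ℕ, γ ^ t * ∑ sa : S × A, ((stateActionDist π P ρ₀ t) sa).toReal * R sa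

theorem PMF.sum_toReal_eq_one {α : Type*} [Fintype α] (p : PMF α) :
    ∑ a, (p a).toReal = 1 := by
  rw [← ENNReal.toReal_sum fun a _ => p.apply_ne_top a, ← tsum_fintype (L := .unconditional _),
    p.tsum_coe, ENNReal.toReal_one]

theorem PMF.toReal_bind_apply {α β : Type*} [Fintype α] (p : PMF α) (f : α → PMF β) (b : β) :
    (p.bind f b).toReal = ∑ a, (p a).toReal * (f a b).toReal := by
  rw [PMF.bind_apply, tsum_fintype, ENNReal.toReal_sum fun a _ =>
    ENNReal.mul_ne_top (p.apply_ne_top a) ((f a).apply_ne_top b)]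
  simp only [ENNReal.toReal_mul]

@[simp]
theorem DTV_self {α : Type*} [Fintype α] (p : PMF α) : DTV p p = 0 := by
  simp [DTV]

theorem DTV_bind_le {α β : Type*} [Fintype α] [Fintype β] (p q : PMF α) (f g : α → PMF β)
    {c : ℝ} (h : ∀ a, DTV (f a) (g a) ≤ c) :
    DTV (p.bind f) (q.bind g) ≤ DTV p q + c := by
  have pointwise (b : β) : |(p.bind f b).toReal - (q.bind g b).toReal| ≤
      ∑ a, (|(p a).toReal - (q a).toReal| * (f a b).toReal +
        (q a).toReal * |(f a b).toReal - (g a b).toReal|) := by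
    rw [PMF.toReal_bind_apply, PMF.toReal_bind_apply, ← Finset.sum_sub_distrib]
    refine (Finset.abs_sum_le_sum_abs _ _).trans (Finset.sum_le_sum fun a _ => ?_)
    calc |(p a).toReal * (f a b).toReal - (q a).toReal * (g a b).toReal|
        = |((p a).toReal - (q a).toReal) * (f a b).toReal +
            (q a).toReal * ((f a b).toReal - (g a b).toReal)| := by ring_nf
      _ ≤ _ := by
        refine (abs_add_le _ _).trans_eq ?_
        rw [abs_mul, abs_mul, abs_of_nonneg (ENNReal.toReal_nonneg (a := f a b)),
          abs_of_nonneg (ENNReal.toReal_nonneg (a := q a))]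
  calc DTV (p.bind f) (q.bind g)
      ≤ 1 / 2 * ∑ b, ∑ a, (|(p a).toReal - (q a).toReal| * (f a b).toReal +
          (q a).toReal * |(f a b).toReal - (g a b).toReal|) := by
        unfold DTV
        gcongr with b
        exact pointwise b
    _ = DTV p q + ∑ a, (q a).toReal * DTV (f a) (g a) := by
        rw [Finset.sum_comm]
        simp only [Finset.sum_add_distrib, ← Finset.mul_sum, PMF.sum_toReal_eq_one, mul_one,
          DTV, mul_add, mul_left_comm _ (1 / 2 : ℝ)]
    _ ≤ DTV p q + ∑ a, (q a).toReal * c := by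
        gcongr with a
        exact h a
    _ = DTV p q + c := by
        rw [← Finset.sum_mul, PMF.sum_toReal_eq_one, one_mul]

theorem DTV_map_le {α β : Type*} [Fintype α] [Fintype β] (p q : PMF α) (f : α → β) :
    DTV (p.map f) (q.map f) ≤ DTV p q := by
  simpa [PMF.map] using
    DTV_bind_le p q (PMF.pure ∘ f) (PMF.pure ∘ f) (c := 0) fun a => (DTV_self _).le

theorem DTV_bind_map_mk_le {S A : Type*} [Fintype S] [Fintype A] (p : PMF S)
    (π₁ π₂ : S → PMF A) :
    DTV (p.bind fun s => (π₁ s).map fun a => (s, a))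
      (p.bind fun s => (π₂ s).map fun a => (s, a)) ≤ ⨆ s, DTV (π₁ s) (π₂ s) := by
  have h := DTV_bind_le p p (fun s => (π₁ s).map fun a => (s, a))
    (fun s => (π₂ s).map fun a => (s, a)) fun s => (DTV_map_le _ _ _).trans
      (le_ciSup (f := fun s => DTV (π₁ s) (π₂ s)) (Set.finite_range _).bddAbove s)
  simpa using h

/-- The time-`t` state–action distributions of two policies in the same environment
differ in total variation by at most `(t+1)` times the maximal per-state policy
total variation. -/
theorem stateActionDist_tv_bound
    {S A : Type*} [Fintype S] [Nonempty S] [Fintype A] [Nonempty A]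
    (ρ₀ : PMF S) (P : S × A → PMF S) (π₁ π₂ : S → PMF A) (t : ℕ) :
    DTV (stateActionDist π₁ P ρ₀ t) (stateActionDist π₂ P ρ₀ t) ≤
      (t + 1 : ℝ) * ⨆ s, DTV (π₁ s) (π₂ s) := by
  induction t with
  | zero => simpa [stateActionDist] using DTV_bind_map_mk_le ρ₀ π₁ π₂
  | succ t ih =>
    have h := DTV_bind_le (stateActionDist π₁ P ρ₀ t) (stateActionDist π₂ P ρ₀ t) _ _
      fun sa => DTV_bind_map_mk_le (P sa) π₁ π₂
    rw [stateActionDist, stateActionDist]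
    push_cast
    linarith
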